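/- For ν = (p) a one-part partition, R_{(p)} := Σ_A χ_A((p)) Σ_{λ,μ} c_{λ,μ}^{A} Q_{λ,μ} equals p_p(x) + p_p(x*), i.e. the sum of the p-th power sums in the two variable sets. -/

import Mathlib

open Finset MvPolynomial

/-- The finite set of partitions of `n`, presented as multisets of parts. -/
def partsF (n : ℕ) : Finset (Multiset ℕ) :=
  Finset.univ.image (fun μ : n.Partition => μ.parts)

/-- `z_μ = ∏_j j^{m_j(μ)} m_j(μ)!`. -/
def zm (μ : Multiset ℕ) : ℕ :=
  μ.toFinset.prod (fun j => j ^ μ.count j * (μ.count j).factorial)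

/-- The conjugate (transpose) partition. -/
def conjM (μ : Multiset ℕ) : Multiset ℕ :=
  (Multiset.range μ.sup).map (fun i => (μ.filter (fun a => i < a)).card)

/-- Complete homogeneous symmetric polynomial with integer index, `0` for negative. -/
noncomputable def hsInt (N : ℕ) (k : ℤ) : MvPolynomial (Fin N) ℚ :=
  if 0 ≤ k then MvPolynomial.hsymm (Fin N) ℚ k.toNat else 0

/-- The Schur polynomial of a weakly decreasing list of parts, via Jacobi–Trudi. -/
noncomputable def schurL (N : ℕ) (l : List ℕ) : MvPolynomial (Fin N) ℚ :=
  (Matrix.of (fun i j : Fin l.length => hsInt N ((l.get i : ℤ) - (i : ℤ) + (j : ℤ)))).det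

/-- The Schur polynomial of a partition given as a multiset of parts. -/
noncomputable def schurM (N : ℕ) (μ : Multiset ℕ) : MvPolynomial (Fin N) ℚ :=
  schurL N ((μ.sort (· ≤ ·)).reverse)

/-- The power sum polynomial `p_μ = ∏_i p_{μ_i}`. -/
noncomputable def pM (N : ℕ) (μ : Multiset ℕ) : MvPolynomial (Fin N) ℚ :=
  (μ.map (fun k => MvPolynomial.psum (Fin N) ℚ k)).prod

/-- Schur function `s_ρ(x)` in the first set of variables of `Λ_x ⊗ Λ_{x*}`. -/
noncomputable def schurX (N : ℕ) (ρ : Multiset ℕ) : MvPolynomial (Fin N ⊕ Fin N) ℚ :=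
  rename Sum.inl (schurM N ρ)

/-- Schur function `s_δ(x*)` in the second set of variables. -/
noncomputable def schurY (N : ℕ) (δ : Multiset ℕ) : MvPolynomial (Fin N ⊕ Fin N) ℚ :=
  rename Sum.inr (schurM N δ)

/-- Power sum `P_B` in the first set of variables. -/
noncomputable def PX (N : ℕ) (B : Multiset ℕ) : MvPolynomial (Fin N ⊕ Fin N) ℚ :=
  rename Sum.inl (pM N B)

/-- Power sum `P*_C` in the second set of variables. -/
noncomputable def PY (N : ℕ) (C : Multiset ℕ) : MvPolynomial (Fin N ⊕ Fin N) ℚ :=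
  rename Sum.inr (pM N C)

/-- `Q_{λ,μ} = Σ_{σ,ρ,δ} (-1)^{|σ|} c_{σ,ρ}^λ c_{σ^t,δ}^μ s_ρ(x) s_δ(x*)`. -/
noncomputable def QQ (N : ℕ) (c : Multiset ℕ → Multiset ℕ → Multiset ℕ → ℚ)
    (lam mu : Multiset ℕ) : MvPolynomial (Fin N ⊕ Fin N) ℚ :=
  ∑ k ∈ Finset.range (min lam.sum mu.sum + 1), ∑ σ ∈ partsF k,
    ∑ ρ ∈ partsF (lam.sum - k), ∑ δ ∈ partsF (mu.sum - k),
      ((-1 : ℚ) ^ k * c σ ρ lam * c (conjM σ) δ mu) • (schurX N ρ * schurY N δ)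

/-- `R_ν = Σ_A χ_A(ν) Σ_{λ,μ} c_{λ,μ}^A Q_{λ,μ}`. -/
noncomputable def RR (N : ℕ) (χ : Multiset ℕ → Multiset ℕ → ℚ)
    (c : Multiset ℕ → Multiset ℕ → Multiset ℕ → ℚ) (ν : Multiset ℕ) :
    MvPolynomial (Fin N ⊕ Fin N) ℚ :=
  ∑ A ∈ partsF ν.sum, χ A ν •
    ∑ d ∈ Finset.range (ν.sum + 1), ∑ lam ∈ partsF d, ∑ mu ∈ partsF (ν.sum - d),
      c lam mu A • QQ N c lam mu



/-! ### Newton's identity for complete homogeneous symmetric polynomials -/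

lemma aux_count_rec (N n : ℕ) (j : Fin N) :
    (∑ s : Sym (Fin N) (n + 1), ((s : Multiset (Fin N)).count j : MvPolynomial (Fin N) ℚ) *
      (s.1.map X).prod) =
    X j * (∑ s : Sym (Fin N) n, ((s : Multiset (Fin N)).count j : MvPolynomial (Fin N) ℚ) *
      (s.1.map X).prod) + X j * hsymm (Fin N) ℚ n := by
  rw [hsymm, ← mul_add, ← Finset.sum_add_distrib, Finset.mul_sum]
  symm
  apply Fintype.sum_of_injective (fun t : Sym (Fin N) n => j ::ₛ t)
  · intro a b hab
    exact (Sym.cons_inj_right j a b).1 hab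
  · intro s hs
    have : j ∉ (s : Multiset (Fin N)) := by
      intro hj
      obtain ⟨t, ht⟩ := Sym.exists_cons_of_mem (Sym.mem_coe.1 hj)
      exact hs ⟨t, ht.symm⟩
    rw [Multiset.count_eq_zero_of_notMem this]
    simp
  · intro t
    simp only [Sym.val_eq_coe, Sym.coe_cons, Multiset.count_cons_self, Multiset.map_cons,
      Multiset.prod_cons]
    push_cast
    ring

lemma aux_count_sum (N n : ℕ) (j : Fin N) :
    (∑ s : Sym (Fin N) n, ((s : Multiset (Fin N)).count j : MvPolynomial (Fin N) ℚ) *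
      (s.1.map X).prod) =
    ∑ i ∈ Finset.range n, X j ^ (i + 1) * hsymm (Fin N) ℚ (n - 1 - i) := by
  induction n with
  | zero => simp [Sym.eq_nil_of_card_zero]
  | succ n ih =>
    rw [aux_count_rec, ih, Finset.sum_range_succ', Finset.mul_sum]
    congr 1
    · apply Finset.sum_congr rfl
      intro i _
      rw [show n + 1 - 1 - (i + 1) = n - 1 - i by omega]
      ring
    · simp

lemma newton_h (N n : ℕ) :
    ((n + 1 : ℕ) : MvPolynomial (Fin N) ℚ) * hsymm (Fin N) ℚ (n + 1) =
    ∑ i ∈ Finset.range (n + 1), psum (Fin N) ℚ (i + 1) * hsymm (Fin N) ℚ (n - i) := by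
  have h1 : ∀ s : Sym (Fin N) (n + 1), ((n + 1 : ℕ) : MvPolynomial (Fin N) ℚ) =
      ∑ j, ((s : Multiset (Fin N)).count j : MvPolynomial (Fin N) ℚ) := by
    intro s
    rw [← Nat.cast_sum, Multiset.sum_count_eq_card (by simp)]
    simp
  rw [hsymm, Finset.mul_sum]
  have h2 : ∀ s ∈ (Finset.univ : Finset (Sym (Fin N) (n + 1))),
      ((n + 1 : ℕ) : MvPolynomial (Fin N) ℚ) * (s.1.map X).prod =
      ∑ j, ((s : Multiset (Fin N)).count j : MvPolynomial (Fin N) ℚ) * (s.1.map X).prod := by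
    intro s _
    rw [h1 s, Finset.sum_mul]
  rw [Finset.sum_congr rfl h2, Finset.sum_comm]
  simp_rw [aux_count_sum]
  rw [Finset.sum_comm]
  apply Finset.sum_congr rfl
  intro i _
  rw [psum, Finset.sum_mul]
  simp

/-! ### Hook determinants -/

/-- Hook Jacobi–Trudi determinant. -/
def hookD {R : Type*} [CommRing R] (h : ℤ → R) (a : ℤ) (r : ℕ) : R :=
  (Matrix.of (fun i j : Fin (r + 1) =>
    h ((if i = 0 then a else 1 - (i : ℤ)) + (j : ℤ)))).det

lemma hookD_zero {R : Type*} [CommRing R] (h : ℤ → R) (a : ℤ) : hookD h a 0 = h a := by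
  simp [hookD]

lemma hookD_rec {R : Type*} [CommRing R] (h : ℤ → R) (h0 : h 0 = 1)
    (hneg : ∀ k < 0, h k = 0) (a : ℤ) (r : ℕ) :
    hookD h a (r + 1) = h a * hookD h 1 r - hookD h (a + 1) r := by
  rw [hookD, Matrix.det_succ_column_zero, Fin.sum_univ_succ, Fin.sum_univ_succ]
  rw [Finset.sum_eq_zero]
  · simp only [hookD, sub_eq_add_neg, add_zero]
    congr 1
    · simp only [Fin.val_zero, pow_zero, one_mul, Matrix.of_apply, if_true, Nat.cast_zero, add_zero]
      congr 2
      ext i j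
      simp only [Matrix.submatrix_apply, Matrix.of_apply]
      congr 1
      by_cases hi : i = 0
      · subst hi; simp; ring
      · simp [hi, Fin.succ_ne_zero]; ring
    · simp only [Matrix.of_apply, Fin.succ_ne_zero, if_false, Fin.val_succ, Fin.val_zero]
      norm_num [h0]
      congr 1
      ext i j
      simp only [Matrix.submatrix_apply, Matrix.of_apply]
      congr 1
      by_cases hi : i = 0
      · subst hi; simp; ring
      · obtain ⟨k, rfl⟩ := Fin.exists_succ_eq.2 hi
        have : (1 : Fin (r + 2)).succAbove k.succ = k.succ.succ := by
          rw [Fin.succAbove_of_le_castSucc]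
          simp [Fin.le_def]
        rw [this]
        simp [Fin.succ_ne_zero]
        ring
  · intro i _
    simp only [Matrix.of_apply, Fin.succ_ne_zero, if_false, Fin.val_succ, Fin.val_zero]
    rw [hneg _ (by push_cast; omega)]
    simp

lemma hookD_zero_succ {R : Type*} [CommRing R] (h : ℤ → R) (r : ℕ) :
    hookD h 0 (r + 1) = 0 := by
  rw [hookD]
  apply Matrix.det_zero_of_row_eq (i := 0) (j := 1) (by simp)
  ext j
  simp

/-- The elementary symmetric functions, as determinants. -/
def elD {R : Type*} [CommRing R] (h : ℤ → R) : ℕ → R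
  | 0 => 1
  | (m + 1) => hookD h 1 m

lemma hookD_sum {R : Type*} [CommRing R] (h : ℤ → R) (h0 : h 0 = 1)
    (hneg : ∀ k < 0, h k = 0) (r : ℕ) : ∀ a : ℤ,
    hookD h a r = ∑ m ∈ Finset.range (r + 1), (-1) ^ (r + m) * h (a + r - m) * elD h m := by
  induction r with
  | zero => intro a; simp [hookD_zero, elD]
  | succ r ih =>
    intro a
    rw [hookD_rec h h0 hneg, ih (a + 1), Finset.sum_range_succ _ (r + 1), sub_eq_neg_add, ← Finset.sum_neg_distrib]
    congr 1
    · apply Finset.sum_congr rfl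
      intro m _
      rw [show a + 1 + (r : ℤ) - m = a + ((r + 1 : ℕ) : ℤ) - m by push_cast; ring]
      ring
    · rw [← two_mul, pow_mul]
      simp [elD]

lemma hook_alt_sum {R : Type*} [CommRing R] (h : ℤ → R) (h0 : h 0 = 1)
    (hneg : ∀ k < 0, h k = 0) (ps : ℕ → R)
    (hnew : ∀ n : ℕ, ((n + 1 : ℕ) : R) * h ((n + 1 : ℕ) : ℤ) =
      ∑ i ∈ Finset.range (n + 1), ps (i + 1) * h ((n - i : ℕ) : ℤ)) (n : ℕ) :
    ∑ r ∈ Finset.range (n + 1), (-1) ^ r * hookD h ((n + 1 : ℕ) - (r : ℤ)) r = ps (n + 1) := by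
  have hEH : (PowerSeries.mk fun m => (-1) ^ m * elD h m) *
      (PowerSeries.mk fun m : ℕ => h (m : ℤ)) = 1 := by
    ext k
    rw [PowerSeries.coeff_mul, Finset.Nat.sum_antidiagonal_eq_sum_range_succ_mk]
    simp only [PowerSeries.coeff_mk]
    have : hookD h 0 k = if k = 0 then 1 else 0 := by
      cases k with
      | zero => simp [hookD_zero, h0]
      | succ k => simp [hookD_zero_succ]
    rw [PowerSeries.coeff_one]
    have h2 := hookD_sum h h0 hneg k 0
    rw [this] at h2
    have h3 : ((-1 : R) ^ k) * (if k = 0 then 1 else 0) = if k = 0 then 1 else 0 := by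
      split_ifs with hk <;> simp [hk]
    rw [← h3, h2, Finset.mul_sum]
    apply Finset.sum_congr rfl
    intro m hm
    rw [Finset.mem_range] at hm
    rw [Nat.cast_sub (by omega), zero_add, pow_add]
    have : ((-1 : R) ^ k) * (-1) ^ k = 1 := by rw [← mul_pow]; simp
    linear_combination (-(-1) ^ m * elD h m * h (k - m)) * this
  have hPH : (PowerSeries.mk fun m => ps (m + 1)) *
      (PowerSeries.mk fun m : ℕ => h (m : ℤ)) =
      PowerSeries.mk fun m : ℕ => ((m + 1 : ℕ) : R) * h ((m + 1 : ℕ) : ℤ) := by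
    ext k
    rw [PowerSeries.coeff_mul, Finset.Nat.sum_antidiagonal_eq_sum_range_succ_mk]
    simp only [PowerSeries.coeff_mk]
    rw [hnew]
  have hfin : (PowerSeries.mk fun m => (-1) ^ m * elD h m) *
      (PowerSeries.mk fun m : ℕ => ((m + 1 : ℕ) : R) * h ((m + 1 : ℕ) : ℤ)) =
      PowerSeries.mk fun m => ps (m + 1) := by
    rw [← hPH, mul_left_comm, hEH, mul_one]
  have hc := congrArg (PowerSeries.coeff n) hfin
  rw [PowerSeries.coeff_mul, Finset.Nat.sum_antidiagonal_eq_sum_range_succ_mk] at hc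
  simp only [PowerSeries.coeff_mk] at hc
  rw [← hc]
  have key : ∀ r ∈ Finset.range (n + 1), (-1) ^ r * hookD h ((n + 1 : ℕ) - (r : ℤ)) r =
      ∑ m ∈ Finset.range (n + 1),
        if m ≤ r then (-1) ^ m * elD h m * h ((n - m + 1 : ℕ) : ℤ) else 0 := by
    intro r hr
    rw [Finset.mem_range] at hr
    rw [hookD_sum h h0 hneg, Finset.mul_sum, ← Finset.sum_filter]
    have : (Finset.range (n + 1)).filter (fun m => m ≤ r) = Finset.range (r + 1) := by
      ext m; simp; omega
    rw [this]
    apply Finset.sum_congr rfl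
    intro m hm
    rw [Finset.mem_range] at hm
    rw [show ((n + 1 : ℕ) : ℤ) - r + r - m = ((n - m + 1 : ℕ) : ℤ) by omega, pow_add]
    have : ((-1 : R) ^ r) * (-1) ^ r = 1 := by rw [← mul_pow]; simp
    linear_combination ((-1) ^ m * elD h m * h ((n - m + 1 : ℕ) : ℤ)) * this
  rw [Finset.sum_congr rfl key, Finset.sum_comm]
  apply Finset.sum_congr rfl
  intro m hm
  rw [Finset.mem_range] at hm
  rw [← Finset.sum_filter, Finset.sum_const]
  have : (Finset.range (n + 1)).filter (fun r => m ≤ r) = Finset.Ico m (n + 1) := by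
    ext r; simp; omega
  rw [this, Nat.card_Ico, nsmul_eq_mul, show n + 1 - m = n - m + 1 by omega]
  ring

/-! ### Basic facts on the objects of the statement -/

lemma mem_partsF {n : ℕ} {μ : Multiset ℕ} :
    μ ∈ partsF n ↔ (∀ i ∈ μ, 0 < i) ∧ μ.sum = n := by
  simp only [partsF, Finset.mem_image, Finset.mem_univ, true_and]
  constructor
  · rintro ⟨q, rfl⟩
    exact ⟨fun i hi => q.parts_pos hi, q.parts_sum⟩
  · rintro ⟨h1, h2⟩
    exact ⟨⟨μ, fun {i} hi => h1 i hi, h2⟩, rfl⟩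

lemma partsF_zero : partsF 0 = {0} := by
  ext μ
  rw [mem_partsF, Finset.mem_singleton]
  constructor
  · rintro ⟨h1, h2⟩
    rw [Multiset.eq_zero_iff_forall_notMem]
    intro a ha
    have := Multiset.le_sum_of_mem ha
    have := h1 a ha
    omega
  · rintro rfl
    simp

lemma hsInt_zero (N : ℕ) : hsInt N 0 = 1 := by simp [hsInt]

lemma hsInt_neg (N : ℕ) : ∀ k < 0, hsInt N k = 0 := by
  intro k hk
  simp [hsInt, not_le.2 hk]

lemma hsInt_nat (N n : ℕ) : hsInt N (n : ℤ) = hsymm (Fin N) ℚ n := by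
  simp [hsInt]

lemma hsInt_newton (N n : ℕ) : ((n + 1 : ℕ) : MvPolynomial (Fin N) ℚ) * hsInt N ((n + 1 : ℕ) : ℤ) =
    ∑ i ∈ Finset.range (n + 1), psum (Fin N) ℚ (i + 1) * hsInt N ((n - i : ℕ) : ℤ) := by
  simp only [hsInt_nat]
  exact newton_h N n

lemma schurM_eq (N : ℕ) (l : List ℕ) (hl : l.Pairwise (· ≥ ·)) :
    schurM N (l : Multiset ℕ) = schurL N l := by
  have : ((l : Multiset ℕ).sort (· ≤ ·)).reverse = l := by
    rw [List.reverse_eq_iff]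
    apply List.Perm.eq_of_pairwise (le := (· ≤ ·))
    · intro a b _ _ h1 h2
      exact le_antisymm h1 h2
    · exact Multiset.pairwise_sort _ _
    · rw [List.pairwise_reverse]
      exact hl
    · rw [← Multiset.coe_eq_coe, Multiset.sort_eq]
      simp
  rw [schurM, this]

lemma exists_list (μ : Multiset ℕ) : ∃ l : List ℕ, l.Pairwise (· ≥ ·) ∧ (l : Multiset ℕ) = μ := by
  refine ⟨(μ.sort (· ≤ ·)).reverse, ?_, ?_⟩
  · rw [List.pairwise_reverse]
    exact Multiset.pairwise_sort μ (· ≤ ·)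
  · rw [Multiset.coe_reverse, Multiset.sort_eq]

lemma schurM_zero (N : ℕ) : schurM N 0 = 1 := by
  have := schurM_eq N [] List.Pairwise.nil
  rw [Multiset.coe_nil] at this
  rw [this]
  simp [schurL]

lemma schurL_hook (N a r : ℕ) :
    schurL N (a :: List.replicate r 1) = hookD (hsInt N) a r := by
  have hlen : (a :: List.replicate r 1).length = r + 1 := by simp
  rw [schurL, hookD, ← Matrix.det_submatrix_equiv_self (finCongr hlen)]
  congr 1
  ext i j : 2
  simp only [Matrix.submatrix_apply, Matrix.of_apply]
  congr 1
  obtain ⟨i, hi⟩ := i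
  cases i with
  | zero => simp
  | succ i => simp [Fin.ext_iff]

lemma schurM_hook (N a r : ℕ) (ha : 0 < a) :
    schurM N (a ::ₘ Multiset.replicate r 1) = hookD (hsInt N) a r := by
  rw [← schurL_hook, ← schurM_eq]
  · rw [← Multiset.cons_coe, Multiset.coe_replicate]
  · rw [List.pairwise_cons]
    refine ⟨?_, ?_⟩
    · intro b hb
      rw [List.eq_of_mem_replicate hb]
      exact ha
    · rw [List.pairwise_replicate]
      simp

/-! ### Evaluation at roots of unity -/

/-- Evaluation at the `p`-th roots of unity. -/
noncomputable def ev (N p : ℕ) : MvPolynomial (Fin N) ℚ →ₐ[ℚ] ℂ :=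
  aeval (fun i : Fin N => if (i : ℕ) < p then (Complex.exp (2 * Real.pi * Complex.I / p)) ^ (i : ℕ) else 0)

lemma ev_psum (N p k : ℕ) (hN : p ≤ N) (hk : 0 < k) :
    ev N p (psum (Fin N) ℚ k) =
      ∑ i ∈ Finset.range p, ((Complex.exp (2 * Real.pi * Complex.I / p)) ^ k) ^ i := by
  simp only [ev, psum, map_sum, map_pow, aeval_X]
  rw [Fin.sum_univ_eq_sum_range (fun i : ℕ =>
    (if i < p then (Complex.exp (2 * Real.pi * Complex.I / p)) ^ i else 0) ^ k) N]
  rw [← Finset.sum_subset (Finset.range_subset_range.2 hN)]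
  · apply Finset.sum_congr rfl
    intro i hi
    rw [if_pos (Finset.mem_range.1 hi), ← pow_mul, ← pow_mul, mul_comm i k]
  · intro i _ hi
    rw [if_neg (by simpa using hi), zero_pow hk.ne']

lemma ev_psum_lt (N p k : ℕ) (hN : p ≤ N) (hk : 0 < k) (hkp : k < p) :
    ev N p (psum (Fin N) ℚ k) = 0 := by
  rw [ev_psum N p k hN hk]
  have hζ := Complex.isPrimitiveRoot_exp p (by omega)
  have h1 := hζ.pow_ne_one_of_pos_of_lt hk.ne' hkp
  rw [geom_sum_eq h1, ← pow_mul, mul_comm k p, pow_mul, hζ.pow_eq_one]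
  simp

lemma ev_psum_self (N p : ℕ) (hN : p ≤ N) (hp : 0 < p) :
    ev N p (psum (Fin N) ℚ p) = p := by
  rw [ev_psum N p p hN hp]
  have hζ := Complex.isPrimitiveRoot_exp p (by omega)
  rw [hζ.pow_eq_one]
  simp

lemma ev_hsInt_lt (N p : ℕ) (hN : p ≤ N) (k : ℤ) (hk : k ≠ 0) (hkp : k < p) :
    ev N p (hsInt N k) = 0 := by
  rcases lt_or_gt_of_ne hk with h | h
  · rw [hsInt_neg N k h, map_zero]
  · obtain ⟨n, rfl⟩ : ∃ n : ℕ, k = ((n + 1 : ℕ) : ℤ) := ⟨(k - 1).toNat, by omega⟩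
    have h1 := congrArg (ev N p) (hsInt_newton N n)
    rw [map_mul, map_natCast, map_sum, Finset.sum_eq_zero] at h1
    · rcases mul_eq_zero.1 h1 with h2 | h2
      · exact absurd h2 (Nat.cast_ne_zero.2 (by omega))
      · exact h2
    · intro i hi
      rw [Finset.mem_range] at hi
      rw [map_mul, ev_psum_lt N p _ hN (by omega) (by omega), zero_mul]

lemma ev_hsInt_self (N p : ℕ) (hN : p ≤ N) (hp : 0 < p) :
    ev N p (hsInt N p) = 1 := by
  obtain ⟨n, rfl⟩ : ∃ n : ℕ, p = n + 1 := ⟨p - 1, by omega⟩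
  have h1 := congrArg (ev N (n + 1)) (hsInt_newton N n)
  rw [map_mul, map_natCast, map_sum, Finset.sum_range_succ, Finset.sum_eq_zero] at h1
  · rw [map_mul, ev_psum_self N (n + 1) hN hp, Nat.sub_self, Nat.cast_zero, hsInt_zero, map_one,
      mul_one, zero_add] at h1
    have h0 : ((n + 1 : ℕ) : ℂ) ≠ 0 := Nat.cast_ne_zero.2 (by omega)
    exact mul_left_cancel₀ h0 (h1.trans (mul_one _).symm)
  · intro i hi
    rw [Finset.mem_range] at hi
    rw [map_mul, ev_psum_lt N _ _ hN (by omega) (by omega), zero_mul]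

lemma ev_pM (N p k : ℕ) (hN : p ≤ N) (hk : 0 < k) (hkp : k ≤ p) (μ : Multiset ℕ)
    (hμ : μ ∈ partsF k) (hne : μ ≠ {p}) : ev N p (pM N μ) = 0 := by
  rw [mem_partsF] at hμ
  obtain ⟨h1, h2⟩ := hμ
  obtain ⟨a, ha⟩ : ∃ a, a ∈ μ := by
    apply Multiset.exists_mem_of_ne_zero
    rintro rfl
    simp at h2
    omega
  obtain ⟨t, rfl⟩ := Multiset.exists_cons_of_mem ha
  rw [Multiset.sum_cons] at h2
  have hap : a < p := by
    by_contra hcon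
    have ht : t = 0 := by
      rw [Multiset.eq_zero_iff_forall_notMem]
      intro b hb
      have := Multiset.le_sum_of_mem hb
      have := h1 b (Multiset.mem_cons_of_mem hb)
      omega
    apply hne
    rw [ht] at h2 ⊢
    have : a = p := by simp at h2; omega
    rw [this]
    rfl
  rw [pM, Multiset.map_cons, Multiset.prod_cons, map_mul, ev_psum_lt N p a hN (h1 a ha) hap,
    zero_mul]

lemma ev_hook (N p : ℕ) (hN : p ≤ N) (r : ℕ) : ∀ a : ℕ, 0 < a → a + r = p →
    ev N p (hookD (hsInt N) a r) = (-1) ^ r := by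
  induction r with
  | zero =>
    intro a ha har
    obtain rfl : a = p := by omega
    rw [hookD_zero, ev_hsInt_self N a hN ha, pow_zero]
  | succ r ih =>
    intro a ha har
    rw [hookD_rec _ (hsInt_zero N) (hsInt_neg N), map_sub, map_mul,
      ev_hsInt_lt N p hN a (by omega) (by omega)]
    have := ih (a + 1) (by omega) (by omega)
    push_cast at this
    rw [this]
    ring

lemma ev_nonhook (N p : ℕ) (hN : p ≤ N) (a b : ℕ) (l : List ℕ) (ha : 0 < a) (hb : 2 ≤ b)
    (hl : ∀ x ∈ l, 0 < x) (hsum : (a :: b :: l).sum = p) :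
    ev N p (schurL N (a :: b :: l)) = 0 := by
  have hlen : l.length ≤ l.sum := by
    have := List.card_nsmul_le_sum l 1 (fun x hx => hl x hx)
    simpa using this
  simp only [List.sum_cons] at hsum
  rw [schurL, AlgHom.map_det]
  apply Matrix.det_eq_zero_of_row_eq_zero ⟨1, by simp⟩
  intro j
  have hj := j.2
  simp only [List.length_cons] at hj
  simp only [AlgHom.mapMatrix_apply, Matrix.map_apply, Matrix.of_apply]
  apply ev_hsInt_lt N p hN
  · simp; omega
  · simp; omega

/-! ### The power sum as an alternating sum of hooks -/

lemma sum_ev_schur (N p : ℕ) (hp : 0 < p) (hN : p ≤ N) (χ : Multiset ℕ → ℚ)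
    (hχ : ∀ A ∈ partsF p, (χ A : ℂ) = ev N p (schurM N A)) :
    ∑ A ∈ partsF p, χ A • schurM N A = psum (Fin N) ℚ p := by
  obtain ⟨n, rfl⟩ : ∃ n : ℕ, p = n + 1 := ⟨p - 1, by omega⟩
  rw [← hook_alt_sum (hsInt N) (hsInt_zero N) (hsInt_neg N) (psum (Fin N) ℚ) (hsInt_newton N) n]
  symm
  apply Finset.sum_of_injOn (fun r => (n + 1 - r) ::ₘ Multiset.replicate r 1)
  · intro r _ s _ hrs
    have := congrArg Multiset.card hrs
    simpa using this
  · intro r hr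
    have hr' : r < n + 1 := by simpa using hr
    rw [Finset.mem_coe, mem_partsF]
    refine ⟨?_, ?_⟩
    · intro i hi
      rw [Multiset.mem_cons] at hi
      rcases hi with rfl | hi
      · omega
      · rw [Multiset.eq_of_mem_replicate hi]; exact one_pos
    · simp; omega
  · intro A hA hnot
    have hA' := mem_partsF.1 hA
    suffices h : χ A = 0 by rw [h, zero_smul]
    have : (χ A : ℂ) = 0 := by
      rw [hχ A hA]
      obtain ⟨l, hl, rfl⟩ := exists_list A
      rw [schurM_eq N l hl]
      simp only [Multiset.mem_coe, Multiset.sum_coe] at hA'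
      obtain ⟨hpos, hsum⟩ := hA'
      match l, hl, hpos, hsum, hnot with
      | [], _, _, hsum, _ => simp at hsum
      | [a], _, _, hsum, hnot =>
        exfalso
        apply hnot
        refine ⟨0, by simp, ?_⟩
        simp at hsum
        simp [hsum]
      | a :: b :: l, hl, hpos, hsum, hnot =>
        by_cases hb : 2 ≤ b
        · exact ev_nonhook N (n + 1) hN a b l (hpos a (by simp)) hb
            (fun x hx => hpos x (by simp [hx])) hsum
        · exfalso
          apply hnot
          have hall : b :: l = List.replicate (l.length + 1) 1 := by
            rw [List.eq_replicate_iff]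
            refine ⟨by simp, ?_⟩
            intro x hx
            have h1 := hpos x (List.mem_cons_of_mem _ hx)
            have h2 : x ≤ b := by
              rw [List.pairwise_cons, List.pairwise_cons] at hl
              rcases List.mem_cons.1 hx with rfl | hx
              · exact le_refl _
              · exact hl.2.1 x hx
            omega
          rw [hall] at hsum ⊢
          have ha := hpos a (by simp)
          simp only [List.sum_cons, List.sum_replicate, smul_eq_mul, mul_one] at hsum
          refine ⟨l.length + 1, ?_, ?_⟩
          · simp; omega
          · have : n + 1 - (l.length + 1) = a := by omega
            simp only [this]
            rw [← Multiset.cons_coe, Multiset.coe_replicate]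
    exact_mod_cast this
  · intro r hr
    rw [Finset.mem_range] at hr
    have hm : (n + 1 - r) ::ₘ Multiset.replicate r 1 ∈ partsF (n + 1) := by
      rw [mem_partsF]
      refine ⟨?_, ?_⟩
      · intro i hi
        rw [Multiset.mem_cons] at hi
        rcases hi with rfl | hi
        · omega
        · rw [Multiset.eq_of_mem_replicate hi]; exact one_pos
      · simp; omega
    have h1 := hχ _ hm
    rw [schurM_hook N _ r (by omega), ev_hook N (n + 1) hN r _ (by omega) (by omega)] at h1
    have h2 : χ ((n + 1 - r) ::ₘ Multiset.replicate r 1) = (-1) ^ r := by exact_mod_cast h1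
    rw [h2, schurM_hook N _ r (by omega), Nat.cast_sub (by omega), MvPolynomial.smul_eq_C_mul]
    simp

/-! ### Pulling everything together -/

lemma chi_eq_ev (N p : ℕ) (hp : 0 < p) (hN : p ≤ N)
    (χ : Multiset ℕ → Multiset ℕ → ℚ)
    (hFrob : ∀ k : ℕ, ∀ Y ∈ partsF k,
      schurM N Y = ∑ μ ∈ partsF k, (χ Y μ / (zm μ : ℚ)) • pM N μ) (A : Multiset ℕ)
    (hA : A ∈ partsF p) : (χ A {p} : ℂ) = ev N p (schurM N A) := by
  rw [hFrob p A hA, map_sum, Finset.sum_eq_single {p}]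
  · have hz : zm {p} = p := by simp [zm]
    have hp0 : (p : ℂ) ≠ 0 := Nat.cast_ne_zero.2 hp.ne'
    rw [map_smul, hz, pM, Multiset.map_singleton, Multiset.prod_singleton,
      ev_psum_self N p hN hp, Rat.smul_def]
    push_cast
    field_simp
  · intro μ hμ hne
    rw [map_smul, ev_pM N p p hN hp le_rfl μ hμ hne, smul_zero]
  · intro h
    exact absurd (mem_partsF.2 ⟨by simpa using hp, by simp⟩) h

lemma ev_schur_lt (N p : ℕ) (hN : p ≤ N)
    (χ : Multiset ℕ → Multiset ℕ → ℚ)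
    (hFrob : ∀ k : ℕ, ∀ Y ∈ partsF k,
      schurM N Y = ∑ μ ∈ partsF k, (χ Y μ / (zm μ : ℚ)) • pM N μ) (k : ℕ) (hk : 0 < k)
    (hkp : k < p) (A : Multiset ℕ) (hA : A ∈ partsF k) : ev N p (schurM N A) = 0 := by
  rw [hFrob k A hA, map_sum, Finset.sum_eq_zero]
  intro μ hμ
  rw [map_smul, ev_pM N p k hN hk hkp.le μ hμ, smul_zero]
  rintro rfl
  have := (mem_partsF.1 hμ).2
  simp at this
  omega

lemma conjM_zero : conjM 0 = 0 := by simp [conjM]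

lemma QQ_right_zero (N : ℕ) (c : Multiset ℕ → Multiset ℕ → Multiset ℕ → ℚ)
    (h0 : c 0 0 0 = 1) (lam : Multiset ℕ) :
    QQ N c lam 0 = ∑ ρ ∈ partsF lam.sum, c 0 ρ lam • schurX N ρ := by
  simp [QQ, partsF_zero, conjM_zero, h0, schurY, schurM_zero]

lemma QQ_left_zero (N : ℕ) (c : Multiset ℕ → Multiset ℕ → Multiset ℕ → ℚ)
    (h0 : c 0 0 0 = 1) (mu : Multiset ℕ) :
    QQ N c 0 mu = ∑ δ ∈ partsF mu.sum, c 0 δ mu • schurY N δ := by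
  simp [QQ, partsF_zero, conjM_zero, h0, schurX, schurM_zero]

/-- For `ν = (p)` a one-part partition,
`R_{(p)} = Σ_A χ_A((p)) Σ_{λ,μ} c_{λ,μ}^A Q_{λ,μ}` equals `p_p(x) + p_p(x*)`,
the sum of the `p`-th power sums in the two sets of variables. Here `χ` is the
symmetric group character table (pinned by the Frobenius formula) and `c` are the
Littlewood–Richardson coefficients (pinned by the Schur product rule). -/
theorem R_one_row_eq_sum_power_sums (N p : ℕ) (hp : 0 < p) (hN : p ≤ N)
    (χ : Multiset ℕ → Multiset ℕ → ℚ)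
    (hFrob : ∀ k : ℕ, ∀ Y ∈ partsF k,
      schurM N Y = ∑ μ ∈ partsF k, (χ Y μ / (zm μ : ℚ)) • pM N μ)
    (c : Multiset ℕ → Multiset ℕ → Multiset ℕ → ℚ)
    (hc : ∀ k l : ℕ, ∀ a ∈ partsF k, ∀ b ∈ partsF l,
      schurM N a * schurM N b = ∑ ν ∈ partsF (k + l), c a b ν • schurM N ν) :
    RR N χ c {p} =
      MvPolynomial.rename Sum.inl (MvPolynomial.psum (Fin N) ℚ p) +
        MvPolynomial.rename Sum.inr (MvPolynomial.psum (Fin N) ℚ p) := by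
  have hχ := chi_eq_ev N p hp hN χ hFrob
  have z0 : (0 : Multiset ℕ) ∈ partsF 0 := by rw [partsF_zero]; simp
  have h000 : c 0 0 0 = 1 := by
    have h1 := hc 0 0 0 z0 0 z0
    rw [add_zero, partsF_zero, Finset.sum_singleton, schurM_zero, mul_one,
      MvPolynomial.smul_eq_C_mul, mul_one] at h1
    have h2 : (C 1 : MvPolynomial (Fin N) ℚ) = C (c 0 0 0) := by rw [← h1, C_1]
    exact (C_injective _ _ h2).symm
  -- the character of an induced product on a `p`-cycle
  have hind : ∀ d ≤ p, ∀ lam ∈ partsF d, ∀ mu ∈ partsF (p - d),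
      ((∑ A ∈ partsF p, χ A {p} * c lam mu A : ℚ) : ℂ) =
        ev N p (schurM N lam) * ev N p (schurM N mu) := by
    intro d hd lam hlam mu hmu
    rw [← map_mul, hc d (p - d) lam hlam mu hmu, Nat.add_sub_cancel' hd, map_sum]
    push_cast
    apply Finset.sum_congr rfl
    intro A hA
    rw [map_smul, Rat.smul_def, hχ A hA]
    ring
  have hind0 : ∀ mu ∈ partsF p, ∑ A ∈ partsF p, χ A {p} * c 0 mu A = χ mu {p} := by
    intro mu hmu
    have h1 := hind 0 (Nat.zero_le _) 0 z0 mu hmu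
    rw [schurM_zero, map_one, one_mul, ← hχ mu hmu] at h1
    exact_mod_cast h1
  have hindp : ∀ lam ∈ partsF p, ∑ A ∈ partsF p, χ A {p} * c lam 0 A = χ lam {p} := by
    intro lam hlam
    have h1 := hind p le_rfl lam hlam 0 (by rw [Nat.sub_self]; exact z0)
    rw [schurM_zero, map_one, mul_one, ← hχ lam hlam] at h1
    exact_mod_cast h1
  have hps := sum_ev_schur N p hp hN (fun A => χ A {p}) hχ
  have hsum : ∀ f : Multiset ℕ → MvPolynomial (Fin N ⊕ Fin N) ℚ,
      ∑ lam ∈ partsF p, χ lam {p} • (∑ ρ ∈ partsF p, c 0 ρ lam • f ρ) =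
        ∑ ρ ∈ partsF p, χ ρ {p} • f ρ := by
    intro f
    simp_rw [Finset.smul_sum, smul_smul]
    rw [Finset.sum_comm]
    apply Finset.sum_congr rfl
    intro ρ hρ
    rw [← Finset.sum_smul, hind0 ρ hρ]
  have hR : RR N χ c {p} = ∑ d ∈ Finset.range (p + 1), ∑ lam ∈ partsF d,
      ∑ mu ∈ partsF (p - d), (∑ A ∈ partsF p, χ A {p} * c lam mu A) • QQ N c lam mu := by
    simp only [RR, Multiset.sum_singleton, Finset.smul_sum, smul_smul]
    rw [Finset.sum_comm]
    apply Finset.sum_congr rfl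
    intro d _
    rw [Finset.sum_comm]
    apply Finset.sum_congr rfl
    intro lam _
    rw [Finset.sum_comm]
    apply Finset.sum_congr rfl
    intro mu _
    rw [Finset.sum_smul]
  have hmid : ∀ d, 0 < d → d < p → ∑ lam ∈ partsF d,
      ∑ mu ∈ partsF (p - d), (∑ A ∈ partsF p, χ A {p} * c lam mu A) • QQ N c lam mu = 0 := by
    intro d h1 h2
    apply Finset.sum_eq_zero
    intro lam hlam
    apply Finset.sum_eq_zero
    intro mu hmu
    have h3 := hind d h2.le lam hlam mu hmu
    rw [ev_schur_lt N p hN χ hFrob d h1 h2 lam hlam, zero_mul] at h3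
    have h4 : ∑ A ∈ partsF p, χ A {p} * c lam mu A = 0 := by exact_mod_cast h3
    rw [h4, zero_smul]
  obtain ⟨n, rfl⟩ : ∃ n : ℕ, p = n + 1 := ⟨p - 1, by omega⟩
  rw [hR, Finset.sum_range_succ, Finset.sum_range_succ', Finset.sum_eq_zero, zero_add, add_comm]
  · refine congrArg₂ (· + ·) ?_ ?_
    · rw [Nat.sub_self, partsF_zero]
      simp only [Finset.sum_singleton]
      rw [← hps, map_sum]
      simp only [map_smul]
      refine Eq.trans ?_ (hsum (schurX N))
      apply Finset.sum_congr rfl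
      intro lam hlam
      rw [hindp lam hlam, QQ_right_zero N c h000, (mem_partsF.1 hlam).2]
    · rw [partsF_zero]
      simp only [Finset.sum_singleton, Nat.sub_zero]
      rw [← hps, map_sum]
      simp only [map_smul]
      refine Eq.trans ?_ (hsum (schurY N))
      apply Finset.sum_congr rfl
      intro mu hmu
      rw [hind0 mu hmu, QQ_left_zero N c h000, (mem_partsF.1 hmu).2]
  · intro i hi
    rw [Finset.mem_range] at hi
    exact hmid (i + 1) (by omega) (by omega)
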